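/- Let v ∈ ℝ, (o₁, o₂) ∈ ℝ², r ∈ ℝ, λ₁, λ₂ > 0, and let x₁, x₂, θ : ℝ → ℝ be differentiable with ẋ₁(t) = v·cos θ(t), ẋ₂(t) = v·sin θ(t), θ̇(t) = ω(t) for a continuous ω : ℝ → ℝ. Define h(t) = (x₁(t) − o₁)² + (x₂(t) − o₂)² − r². Suppose that for all t ≥ 0 the ECBF constraint holds: 2v² + 2v·ω(t)·((x₂(t) − o₂)·cos θ(t) − (x₁(t) − o₁)·sin θ(t)) + (λ₁ + λ₂)·h'(t) + λ₁·λ₂·h(t) ≥ 0, and suppose h(0) ≥ 0 and h'(0) + λ₁·h(0) ≥ 0. Then for all t ≥ 0, (x₁(t) − o₁)² + (x₂(t) − o₂)² ≥ r², i.e., the robot never enters the obstacle disk. -/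

import Mathlib

/-- Comparison principle: if `f' + c f ≥ 0` on `[0, ∞)` and `f 0 ≥ 0`, then `f ≥ 0` on `[0, ∞)`. -/
theorem nonneg_of_hasDerivAt_add_mul_nonneg {f f' : ℝ → ℝ} {c : ℝ}
    (hf : ∀ t, HasDerivAt f (f' t) t) (hc : ∀ t, 0 ≤ t → 0 ≤ f' t + c * f t)
    (h0 : 0 ≤ f 0) {t : ℝ} (ht : 0 ≤ t) : 0 ≤ f t := by
  have hd (s : ℝ) : HasDerivAt (fun s => Real.exp (c * s) * f s)
      (Real.exp (c * s) * (f' s + c * f s)) s := by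
    refine (((hasDerivAt_id' s).const_mul c).exp.mul (hf s)).congr_deriv ?_
    ring
  have hmono : MonotoneOn (fun s => Real.exp (c * s) * f s) (Set.Ici 0) := by
    refine monotoneOn_of_deriv_nonneg (convex_Ici 0)
      (fun s _ => (hd s).continuousAt.continuousWithinAt)
      (fun s _ => (hd s).differentiableAt.differentiableWithinAt) fun s hs => ?_
    rw [(hd s).deriv]
    exact mul_nonneg (Real.exp_pos _).le (hc s (interior_subset hs))
  have key := hmono Set.self_mem_Ici ht ht
  simp only [mul_zero, Real.exp_zero, one_mul] at key
  exact nonneg_of_mul_nonneg_right (h0.trans key) (Real.exp_pos _)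


/-- Safety of the unicycle with a static circular obstacle under the ECBF-QP
constraint `ḧ + (λ₁+λ₂) ḣ + λ₁λ₂ h ≥ 0` with suitable initial conditions:
the robot never enters the obstacle disk. -/
theorem unicycle_static_obstacle_safety
    (v o1 o2 r lam1 lam2 : ℝ) (hlam1 : 0 < lam1) (hlam2 : 0 < lam2)
    (x1 x2 θ ω : ℝ → ℝ) (hω : Continuous ω)
    (hx1 : ∀ t, HasDerivAt x1 (v * Real.cos (θ t)) t)
    (hx2 : ∀ t, HasDerivAt x2 (v * Real.sin (θ t)) t)
    (hθ : ∀ t, HasDerivAt θ (ω t) t)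
    (h : ℝ → ℝ)
    (hh : h = fun t => (x1 t - o1) ^ 2 + (x2 t - o2) ^ 2 - r ^ 2)
    (hecbf : ∀ t : ℝ, 0 ≤ t →
      2 * v ^ 2 + 2 * v * ω t *
          ((x2 t - o2) * Real.cos (θ t) - (x1 t - o1) * Real.sin (θ t))
        + (lam1 + lam2) * deriv h t + lam1 * lam2 * h t ≥ 0)
    (h0 : h 0 ≥ 0) (h0' : deriv h 0 + lam1 * h 0 ≥ 0) :
    ∀ t : ℝ, 0 ≤ t → (x1 t - o1) ^ 2 + (x2 t - o2) ^ 2 ≥ r ^ 2 := by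
  have hd (t : ℝ) : HasDerivAt h
      (2 * v * ((x1 t - o1) * Real.cos (θ t) + (x2 t - o2) * Real.sin (θ t))) t := by
    rw [hh]
    refine (((((hx1 t).sub_const o1).pow 2).add (((hx2 t).sub_const o2).pow 2)).sub_const
      (r ^ 2)).congr_deriv ?_
    norm_num
    ring
  have hd' : deriv h = fun t =>
      2 * v * ((x1 t - o1) * Real.cos (θ t) + (x2 t - o2) * Real.sin (θ t)) :=
    funext fun t => (hd t).deriv
  have hdd (t : ℝ) : HasDerivAt (deriv h) (2 * v ^ 2 + 2 * v * ω t *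
      ((x2 t - o2) * Real.cos (θ t) - (x1 t - o1) * Real.sin (θ t))) t := by
    rw [hd']
    refine (((((hx1 t).sub_const o1).mul (hθ t).cos).add
      (((hx2 t).sub_const o2).mul (hθ t).sin)).const_mul (2 * v)).congr_deriv ?_
    linear_combination (2 * v ^ 2) * Real.sin_sq_add_cos_sq (θ t)
  have hder (t : ℝ) : HasDerivAt h (deriv h t) t := (hd t).differentiableAt.hasDerivAt
  intro t ht
  have hg (s : ℝ) (hs : 0 ≤ s) : 0 ≤ deriv h s + lam1 * h s :=
    nonneg_of_hasDerivAt_add_mul_nonneg (f := fun s => deriv h s + lam1 * h s) (c := lam2)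
      (fun u => (hdd u).add ((hder u).const_mul lam1))
      (fun u hu => by linarith [hecbf u hu]) h0' hs
  have hnonneg := nonneg_of_hasDerivAt_add_mul_nonneg hder hg h0 ht
  simp only [hh] at hnonneg
  linarith
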